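/- (Truth lemma for the canonical model) Let W be the set of all maximal J_n.lin-consistent sets of L_{[<n]}-formulas with the canonical relations <_m, equipped with the natural valuation under which a propositional variable p holds at x iff p ∈ x. Then for every L_{[<n]}-formula ψ and every x ∈ W: W, x ⊩ ψ if and only if ψ ∈ x. -/

import Mathlib

/-- Formulas of the polymodal language `L_{[<ω]}`: propositional variables,
a constant ⊤, Boolean connectives, and a modality `[m]` for each `m : ℕ`. -/
inductive Formula : Type
  | var : ℕ → Formula
  | top : Formula
  | neg : Formula → Formula
  | and : Formula → Formula → Formula
  | or : Formula → Formula → Formula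
  | imp : Formula → Formula → Formula
  | box : ℕ → Formula → Formula
  deriving DecidableEq

namespace Formula

/-- `⊥` abbreviates `¬⊤`. -/
def bot : Formula := neg top

/-- `⟨m⟩φ` abbreviates `¬[m]¬φ`. -/
def dia (m : ℕ) (φ : Formula) : Formula := neg (box m (neg φ))

/-- A formula is closed if it contains no propositional variables. -/
def Closed : Formula → Prop
  | var _ => False
  | top => True
  | neg a => Closed a
  | and a b => Closed a ∧ Closed b
  | or a b => Closed a ∧ Closed b
  | imp a b => Closed a ∧ Closed b
  | box _ a => Closed a

/-- Membership in the language `L_{[<n]}`: all modalities `[m]` have `m < n`. -/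
def InLang (n : ℕ) : Formula → Prop
  | var _ => True
  | top => True
  | neg a => InLang n a
  | and a b => InLang n a ∧ InLang n b
  | or a b => InLang n a ∧ InLang n b
  | imp a b => InLang n a ∧ InLang n b
  | box m a => m < n ∧ InLang n a

/-- Uniform substitution of formulas for propositional variables. -/
def subst (σ : ℕ → Formula) : Formula → Formula
  | var i => σ i
  | top => top
  | neg a => neg (subst σ a)
  | and a b => and (subst σ a) (subst σ b)
  | or a b => or (subst σ a) (subst σ b)
  | imp a b => imp (subst σ a) (subst σ b)
  | box m a => box m (subst σ a)

/-- The number of occurrences of modal operators in a formula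
(diamonds `⟨m⟩` are abbreviations `¬[m]¬`, so each is one box occurrence). -/
def modalCount : Formula → ℕ
  | var _ => 0
  | top => 0
  | neg a => modalCount a
  | and a b => modalCount a + modalCount b
  | or a b => modalCount a + modalCount b
  | imp a b => modalCount a + modalCount b
  | box _ a => modalCount a + 1

end Formula

/-- Conjunction of a finite list of formulas. -/
def bigConj (l : List Formula) : Formula := l.foldr Formula.and Formula.top

/-- `⋀_{m ≤ k < n} [k]φ`. -/
def boxConj (m n : ℕ) (φ : Formula) : Formula :=
  bigConj ((List.range' m (n - m)).map fun k => Formula.box k φ)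

/-- The pseudo-linearity axiom
`[m]((⋀_{m≤k<n}[k]φ) → ψ) ∨ [m]((⋀_{m≤k<n}[k]ψ ∧ ψ) → φ)`. -/
def psLin (n m : ℕ) (φ ψ : Formula) : Formula :=
  Formula.or
    (Formula.box m (Formula.imp (boxConj m n φ) ψ))
    (Formula.box m (Formula.imp (Formula.and (boxConj m n ψ) ψ) φ))

/-- A Boolean valuation of formulas respecting the Boolean connectives
(treating boxed formulas and variables as atoms). -/
def RespectsBool (v : Formula → Bool) : Prop :=
  v Formula.top = true ∧
  (∀ a, v (Formula.neg a) = !(v a)) ∧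
  (∀ a b, v (Formula.and a b) = (v a && v b)) ∧
  (∀ a b, v (Formula.or a b) = (v a || v b)) ∧
  (∀ a b, v (Formula.imp a b) = (!(v a) || v b))

/-- Propositional tautologies of the modal language. -/
def Tautology (φ : Formula) : Prop :=
  ∀ v : Formula → Bool, RespectsBool v → v φ = true

/-- Japaridze's polymodal provability logic `GLP`. -/
inductive GLP : Formula → Prop
  | taut {φ : Formula} : Tautology φ → GLP φ
  | distr (m : ℕ) (φ ψ : Formula) :
      GLP (Formula.imp (Formula.box m (Formula.imp φ ψ))
        (Formula.imp (Formula.box m φ) (Formula.box m ψ)))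
  | lob (m : ℕ) (φ : Formula) :
      GLP (Formula.imp (Formula.box m (Formula.imp (Formula.box m φ) φ)) (Formula.box m φ))
  | mono (m : ℕ) (φ : Formula) :
      GLP (Formula.imp (Formula.box m φ) (Formula.box (m + 1) φ))
  | diaMono (m : ℕ) (φ : Formula) :
      GLP (Formula.imp (Formula.dia m φ) (Formula.box (m + 1) (Formula.dia m φ)))
  | mp {φ ψ : Formula} : GLP (Formula.imp φ ψ) → GLP φ → GLP ψ
  | nec (m : ℕ) {φ : Formula} : GLP φ → GLP (Formula.box m φ)

/-- The logic `GLP.3`: `GLP` together with the linearity axioms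
`[m]([m]A → B) ∨ [m]([m]B ∧ B → A)`. -/
inductive GLP3 : Formula → Prop
  | taut {φ : Formula} : Tautology φ → GLP3 φ
  | distr (m : ℕ) (φ ψ : Formula) :
      GLP3 (Formula.imp (Formula.box m (Formula.imp φ ψ))
        (Formula.imp (Formula.box m φ) (Formula.box m ψ)))
  | lob (m : ℕ) (φ : Formula) :
      GLP3 (Formula.imp (Formula.box m (Formula.imp (Formula.box m φ) φ)) (Formula.box m φ))
  | mono (m : ℕ) (φ : Formula) :
      GLP3 (Formula.imp (Formula.box m φ) (Formula.box (m + 1) φ))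
  | diaMono (m : ℕ) (φ : Formula) :
      GLP3 (Formula.imp (Formula.dia m φ) (Formula.box (m + 1) (Formula.dia m φ)))
  | lin (m : ℕ) (A B : Formula) :
      GLP3 (Formula.or (Formula.box m (Formula.imp (Formula.box m A) B))
        (Formula.box m (Formula.imp (Formula.and (Formula.box m B) B) A)))
  | mp {φ ψ : Formula} : GLP3 (Formula.imp φ ψ) → GLP3 φ → GLP3 ψ
  | nec (m : ℕ) {φ : Formula} : GLP3 φ → GLP3 (Formula.box m φ)

/-- The logic `GLP_n`, i.e. `GLP` restricted to the language `L_{[<n]}`. -/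
inductive GLPn (n : ℕ) : Formula → Prop
  | taut {φ : Formula} : Tautology φ → Formula.InLang n φ → GLPn n φ
  | distr {m : ℕ} (hm : m < n) (φ ψ : Formula)
      (hφ : Formula.InLang n φ) (hψ : Formula.InLang n ψ) :
      GLPn n (Formula.imp (Formula.box m (Formula.imp φ ψ))
        (Formula.imp (Formula.box m φ) (Formula.box m ψ)))
  | lob {m : ℕ} (hm : m < n) (φ : Formula) (hφ : Formula.InLang n φ) :
      GLPn n (Formula.imp (Formula.box m (Formula.imp (Formula.box m φ) φ)) (Formula.box m φ))
  | mono {m : ℕ} (hm : m + 1 < n) (φ : Formula) (hφ : Formula.InLang n φ) :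
      GLPn n (Formula.imp (Formula.box m φ) (Formula.box (m + 1) φ))
  | diaMono {m : ℕ} (hm : m + 1 < n) (φ : Formula) (hφ : Formula.InLang n φ) :
      GLPn n (Formula.imp (Formula.dia m φ) (Formula.box (m + 1) (Formula.dia m φ)))
  | mp {φ ψ : Formula} : GLPn n (Formula.imp φ ψ) → GLPn n φ → GLPn n ψ
  | nec {m : ℕ} (hm : m < n) {φ : Formula} : GLPn n φ → GLPn n (Formula.box m φ)

/-- The logic `GLP_n.3`: `GLP_n` with the linearity axioms for each `m < n`. -/
inductive GLPn3 (n : ℕ) : Formula → Prop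
  | taut {φ : Formula} : Tautology φ → Formula.InLang n φ → GLPn3 n φ
  | distr {m : ℕ} (hm : m < n) (φ ψ : Formula)
      (hφ : Formula.InLang n φ) (hψ : Formula.InLang n ψ) :
      GLPn3 n (Formula.imp (Formula.box m (Formula.imp φ ψ))
        (Formula.imp (Formula.box m φ) (Formula.box m ψ)))
  | lob {m : ℕ} (hm : m < n) (φ : Formula) (hφ : Formula.InLang n φ) :
      GLPn3 n (Formula.imp (Formula.box m (Formula.imp (Formula.box m φ) φ)) (Formula.box m φ))
  | mono {m : ℕ} (hm : m + 1 < n) (φ : Formula) (hφ : Formula.InLang n φ) :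
      GLPn3 n (Formula.imp (Formula.box m φ) (Formula.box (m + 1) φ))
  | diaMono {m : ℕ} (hm : m + 1 < n) (φ : Formula) (hφ : Formula.InLang n φ) :
      GLPn3 n (Formula.imp (Formula.dia m φ) (Formula.box (m + 1) (Formula.dia m φ)))
  | lin {m : ℕ} (hm : m < n) (A B : Formula)
      (hA : Formula.InLang n A) (hB : Formula.InLang n B) :
      GLPn3 n (Formula.or (Formula.box m (Formula.imp (Formula.box m A) B))
        (Formula.box m (Formula.imp (Formula.and (Formula.box m B) B) A)))
  | mp {φ ψ : Formula} : GLPn3 n (Formula.imp φ ψ) → GLPn3 n φ → GLPn3 n ψ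
  | nec {m : ℕ} (hm : m < n) {φ : Formula} : GLPn3 n φ → GLPn3 n (Formula.box m φ)

/-- Beklemishev's logic `J_n`. -/
inductive Jn (n : ℕ) : Formula → Prop
  | taut {φ : Formula} : Tautology φ → Formula.InLang n φ → Jn n φ
  | distr {k : ℕ} (hk : k < n) (φ ψ : Formula)
      (hφ : Formula.InLang n φ) (hψ : Formula.InLang n ψ) :
      Jn n (Formula.imp (Formula.box k (Formula.imp φ ψ))
        (Formula.imp (Formula.box k φ) (Formula.box k ψ)))
  | lob {k : ℕ} (hk : k < n) (φ : Formula) (hφ : Formula.InLang n φ) :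
      Jn n (Formula.imp (Formula.box k (Formula.imp (Formula.box k φ) φ)) (Formula.box k φ))
  | trans1 {k m : ℕ} (hkm : k ≤ m) (hm : m < n) (φ : Formula) (hφ : Formula.InLang n φ) :
      Jn n (Formula.imp (Formula.box k φ) (Formula.box k (Formula.box m φ)))
  | trans2 {k m : ℕ} (hkm : k ≤ m) (hm : m < n) (φ : Formula) (hφ : Formula.InLang n φ) :
      Jn n (Formula.imp (Formula.box k φ) (Formula.box m (Formula.box k φ)))
  | diaMono {k m : ℕ} (hkm : k < m) (hm : m < n) (φ : Formula) (hφ : Formula.InLang n φ) :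
      Jn n (Formula.imp (Formula.dia k φ) (Formula.box m (Formula.dia k φ)))
  | mp {φ ψ : Formula} : Jn n (Formula.imp φ ψ) → Jn n φ → Jn n ψ
  | nec {k : ℕ} (hk : k < n) {φ : Formula} : Jn n φ → Jn n (Formula.box k φ)

/-- The logic `J_n.lin`: `J_n` together with the pseudo-linearity axioms. -/
inductive JnLin (n : ℕ) : Formula → Prop
  | taut {φ : Formula} : Tautology φ → Formula.InLang n φ → JnLin n φ
  | distr {k : ℕ} (hk : k < n) (φ ψ : Formula)
      (hφ : Formula.InLang n φ) (hψ : Formula.InLang n ψ) :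
      JnLin n (Formula.imp (Formula.box k (Formula.imp φ ψ))
        (Formula.imp (Formula.box k φ) (Formula.box k ψ)))
  | lob {k : ℕ} (hk : k < n) (φ : Formula) (hφ : Formula.InLang n φ) :
      JnLin n (Formula.imp (Formula.box k (Formula.imp (Formula.box k φ) φ)) (Formula.box k φ))
  | trans1 {k m : ℕ} (hkm : k ≤ m) (hm : m < n) (φ : Formula) (hφ : Formula.InLang n φ) :
      JnLin n (Formula.imp (Formula.box k φ) (Formula.box k (Formula.box m φ)))
  | trans2 {k m : ℕ} (hkm : k ≤ m) (hm : m < n) (φ : Formula) (hφ : Formula.InLang n φ) :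
      JnLin n (Formula.imp (Formula.box k φ) (Formula.box m (Formula.box k φ)))
  | diaMono {k m : ℕ} (hkm : k < m) (hm : m < n) (φ : Formula) (hφ : Formula.InLang n φ) :
      JnLin n (Formula.imp (Formula.dia k φ) (Formula.box m (Formula.dia k φ)))
  | lin {m : ℕ} (hm : m < n) (φ ψ : Formula)
      (hφ : Formula.InLang n φ) (hψ : Formula.InLang n ψ) :
      JnLin n (psLin n m φ ψ)
  | mp {φ ψ : Formula} : JnLin n (Formula.imp φ ψ) → JnLin n φ → JnLin n ψ
  | nec {k : ℕ} (hk : k < n) {φ : Formula} : JnLin n φ → JnLin n (Formula.box k φ)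

section Frames

variable {T : Type*}

/-- `(T, <_0, …, <_{n-1})` (encoded as `R : ℕ → T → T → Prop`, only the
relations `R i` for `i < n` being relevant) is a `J_n`-frame. -/
def IsJnFrame (n : ℕ) (R : ℕ → T → T → Prop) : Prop :=
  (∀ i < n, Irreflexive (R i)) ∧
  (∀ i < n, Transitive (R i)) ∧
  (∀ i < n, WellFounded fun a b => R i b a) ∧
  ∀ ⦃k m : ℕ⦄, k < m → m < n →
    (∀ ⦃x y z : T⦄, R m x y → R k y z → R k x z) ∧
    (∀ ⦃x y z : T⦄, R k x y → R m y z → R k x z) ∧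
    (∀ ⦃x y z : T⦄, R k x z → R m y z → R k x y)

/-- A frame is hereditarily linear if any two distinct points are comparable
by some relation `<_k`, `k < n`. -/
def HereditarilyLinear (n : ℕ) (R : ℕ → T → T → Prop) : Prop :=
  ∀ x y : T, x ≠ y → ∃ k < n, R k x y ∨ R k y x

/-- A frame is stratified if `x <_m y` and `z <_k y` imply `x <_m z` for `k < m < n`. -/
def Stratified (n : ℕ) (R : ℕ → T → T → Prop) : Prop :=
  ∀ ⦃k m : ℕ⦄, k < m → m < n → ∀ ⦃x y z : T⦄, R m x y → R k z y → R m x z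

/-- The relations `≡_k` (for `k ≤ n`): `≡_n` is identity and `≡_k` is the
equivalence relation generated by the union of `<_k` and `≡_{k+1}`.
Equivalence classes of `≡_k` are the `k`-planes. -/
def eqvRel (R : ℕ → T → T → Prop) (n : ℕ) (k : ℕ) : T → T → Prop :=
  if _ : k < n then
    Relation.EqvGen fun x y => R k x y ∨ eqvRel R n (k + 1) x y
  else Eq
termination_by n - k
decreasing_by omega

/-- Kripke satisfaction in the model `(T, R, V)`. -/
def Sat (R : ℕ → T → T → Prop) (V : ℕ → T → Prop) : T → Formula → Prop
  | w, Formula.var p => V p w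
  | _, Formula.top => True
  | w, Formula.neg a => ¬ Sat R V w a
  | w, Formula.and a b => Sat R V w a ∧ Sat R V w b
  | w, Formula.or a b => Sat R V w a ∨ Sat R V w b
  | w, Formula.imp a b => Sat R V w a → Sat R V w b
  | w, Formula.box m a => ∀ v : T, R m w v → Sat R V v a

end Frames

/-- A set of formulas is consistent with the logic `L` if no finite conjunction
of its elements has its negation provable in `L`. -/
def SetConsistent (L : Formula → Prop) (S : Set Formula) : Prop :=
  ∀ l : List Formula, (∀ φ ∈ l, φ ∈ S) → ¬ L (Formula.neg (bigConj l))

/-- A maximal `L`-consistent set of `L_{[<n]}`-formulas. -/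
def MCS (L : Formula → Prop) (n : ℕ) (S : Set Formula) : Prop :=
  (∀ φ ∈ S, Formula.InLang n φ) ∧ SetConsistent L S ∧
  ∀ S' : Set Formula, (∀ φ ∈ S', Formula.InLang n φ) → S ⊆ S' → S ≠ S' → ¬ SetConsistent L S'

/-- The canonical accessibility relation `x <_m y`. -/
def canonR (m : ℕ) (x y : Set Formula) : Prop :=
  (∀ ψ : Formula, Formula.box m ψ ∈ x → ψ ∈ y) ∧
  (∃ ψ : Formula, Formula.box m ψ ∈ y ∧ Formula.box m ψ ∉ x)

/-- A set of formulas is `k`-maximal if it contains `¬ψ ∧ ⋀_{k≤m<n}[m]ψ` for some `ψ`. -/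
def kMaximal (n k : ℕ) (S : Set Formula) : Prop :=
  ∃ ψ : Formula, Formula.and (Formula.neg ψ) (boxConj k n ψ) ∈ S

theorem RespectsBool.bigConj_eq_true {v : Formula → Bool} (hv : RespectsBool v)
    (l : List Formula) : v (bigConj l) = true ↔ ∀ a ∈ l, v a = true := by
  obtain ⟨htop, -, hand, -, -⟩ := hv
  induction l with
  | nil => simp [bigConj, htop]
  | cons a l ih =>
    have hcons : bigConj (a :: l) = Formula.and a (bigConj l) := rfl
    simp [hcons, hand, ih]

theorem RespectsBool.imp_eq_true {v : Formula → Bool} (hv : RespectsBool v) (a b : Formula) :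
    v (Formula.imp a b) = true ↔ (v a = true → v b = true) := by
  rw [hv.2.2.2.2]
  cases v a <;> simp

theorem RespectsBool.neg_eq_true {v : Formula → Bool} (hv : RespectsBool v) (a : Formula) :
    v (Formula.neg a) = true ↔ ¬ v a = true := by
  simp [hv.2.1]

theorem RespectsBool.and_eq_true {v : Formula → Bool} (hv : RespectsBool v) (a b : Formula) :
    v (Formula.and a b) = true ↔ (v a = true ∧ v b = true) := by
  simp [hv.2.2.1]

theorem RespectsBool.or_eq_true {v : Formula → Bool} (hv : RespectsBool v) (a b : Formula) :
    v (Formula.or a b) = true ↔ (v a = true ∨ v b = true) := by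
  simp [hv.2.2.2.1]

theorem inLang_bigConj {n : ℕ} {l : List Formula} (hl : ∀ a ∈ l, Formula.InLang n a) :
    Formula.InLang n (bigConj l) := by
  induction l with
  | nil => trivial
  | cons a l ih =>
    exact ⟨hl a (by simp), ih fun b hb => hl b (by simp [hb])⟩

/-- Lindenbaum's lemma: every consistent set of `L_{[<n]}`-formulas extends to a maximal one. -/
theorem SetConsistent.exists_mcs {L : Formula → Prop} {n : ℕ} {S : Set Formula}
    (hlang : ∀ φ ∈ S, Formula.InLang n φ) (hS : SetConsistent L S) :
    ∃ T, S ⊆ T ∧ MCS L n T := by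
  obtain ⟨T, hST, hT⟩ := zorn_subset_nonempty
    {T : Set Formula | (∀ φ ∈ T, Formula.InLang n φ) ∧ SetConsistent L T}
    (fun c hc hchain hne => by
      refine ⟨⋃₀ c, ⟨?_, ?_⟩, fun s hs => Set.subset_sUnion_of_mem hs⟩
      · rintro φ ⟨s, hs, hφ⟩
        exact (hc hs).1 φ hφ
      · intro l hl
        obtain ⟨s, hs, hls⟩ := hchain.directedOn.exists_mem_subset_of_finite_of_subset_sUnion hne
          (List.finite_toSet l) hl
        exact (hc hs).2 l hls)
    S ⟨hlang, hS⟩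
  refine ⟨T, hST, hT.prop.1, hT.prop.2, fun S' hS' hsub hne hcons => hne ?_⟩
  exact hT.eq_of_subset ⟨hS', hcons⟩ hsub

namespace MCS

variable {n : ℕ} {x : Set Formula}

theorem exists_provable_neg_of_not_mem (hx : MCS (JnLin n) n x) {φ : Formula}
    (hφ : Formula.InLang n φ) (hmem : φ ∉ x) :
    ∃ l : List Formula, (∀ a ∈ l, a ∈ x) ∧
      JnLin n (Formula.imp (bigConj l) (Formula.neg φ)) := by
  have hlang : ∀ a ∈ insert φ x, Formula.InLang n a := by
    rintro a (rfl | ha)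
    exacts [hφ, hx.1 a ha]
  have hincons := hx.2.2 (insert φ x) hlang (Set.subset_insert φ x)
    (fun he => hmem (he ▸ Set.mem_insert φ x))
  simp only [SetConsistent, not_forall, not_not] at hincons
  obtain ⟨l, hl, hprov⟩ := hincons
  have hrest : ∀ a ∈ l.filter (· ≠ φ), a ∈ x := by
    intro a ha
    simp only [List.mem_filter, decide_eq_true_eq] at ha
    exact (hl a ha.1).resolve_left ha.2
  refine ⟨_, hrest, .mp (.taut (fun v hv => ?_) ?_) hprov⟩
  · simp only [hv.imp_eq_true, hv.neg_eq_true, hv.bigConj_eq_true]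
    intro h₁ h₂ h₃
    refine h₁ fun a ha => ?_
    by_cases hne : a = φ
    · exact hne ▸ h₃
    · exact h₂ a (by simp [ha, hne])
  · exact ⟨inLang_bigConj fun a ha => hlang a (hl a ha),
      inLang_bigConj fun a ha => hx.1 a (hrest a ha), hφ⟩

/-- Maximal consistent sets are deductively closed. -/
theorem mem_of_provable_imp (hx : MCS (JnLin n) n x) {l : List Formula} (hl : ∀ a ∈ l, a ∈ x)
    {φ : Formula} (hφ : Formula.InLang n φ) (h : JnLin n (Formula.imp (bigConj l) φ)) :
    φ ∈ x := by
  by_contra hmem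
  obtain ⟨l', hl', hprov⟩ := hx.exists_provable_neg_of_not_mem hφ hmem
  have happ : ∀ a ∈ l ++ l', a ∈ x := fun a ha => (List.mem_append.1 ha).elim (hl a) (hl' a)
  refine hx.2.1 _ happ (.mp (.mp (.taut (fun v hv => ?_) ?_) h) hprov)
  · simp only [hv.imp_eq_true, hv.neg_eq_true, hv.bigConj_eq_true, List.forall_mem_append]
    tauto
  · exact ⟨⟨inLang_bigConj fun a ha => hx.1 a (hl a ha), hφ⟩,
      ⟨inLang_bigConj fun a ha => hx.1 a (hl' a ha), hφ⟩,
      inLang_bigConj fun a ha => hx.1 a (happ a ha)⟩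

theorem mem_of_entails (hx : MCS (JnLin n) n x) {l : List Formula} (hl : ∀ a ∈ l, a ∈ x)
    {φ : Formula} (hφ : Formula.InLang n φ)
    (h : ∀ v, RespectsBool v → (∀ a ∈ l, v a = true) → v φ = true) : φ ∈ x :=
  hx.mem_of_provable_imp hl hφ <| .taut
    (fun v hv => by simpa only [hv.imp_eq_true, hv.bigConj_eq_true] using h v hv)
    ⟨inLang_bigConj fun a ha => hx.1 a (hl a ha), hφ⟩

theorem mem_of_provable (hx : MCS (JnLin n) n x) {φ : Formula} (hφ : Formula.InLang n φ)
    (h : JnLin n φ) : φ ∈ x :=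
  hx.mem_of_provable_imp (l := []) (by simp) hφ <| .mp (.taut
    (fun v hv => by simp only [hv.imp_eq_true]; exact fun h _ => h) ⟨hφ, trivial, hφ⟩) h

theorem mem_of_imp_mem (hx : MCS (JnLin n) n x) {φ ψ : Formula}
    (himp : Formula.imp φ ψ ∈ x) (hφ : φ ∈ x) : ψ ∈ x :=
  hx.mem_of_entails (l := [Formula.imp φ ψ, φ]) (by simp [himp, hφ]) (hx.1 _ himp).2
    (fun v hv => by simp +contextual [hv.imp_eq_true])

theorem neg_mem_iff (hx : MCS (JnLin n) n x) {φ : Formula} (hφ : Formula.InLang n φ) :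
    Formula.neg φ ∈ x ↔ φ ∉ x := by
  constructor
  · intro hneg hmem
    refine hx.2.1 [φ, Formula.neg φ] (by simp [hneg, hmem]) (.taut (fun v hv => ?_) ?_)
    · simp [hv.neg_eq_true, hv.bigConj_eq_true]
    · exact ⟨hφ, hφ, trivial⟩
  · intro hmem
    obtain ⟨l, hl, hprov⟩ := hx.exists_provable_neg_of_not_mem hφ hmem
    exact hx.mem_of_provable_imp hl hφ hprov

theorem and_mem_iff (hx : MCS (JnLin n) n x) {φ ψ : Formula} (hφ : Formula.InLang n φ)
    (hψ : Formula.InLang n ψ) : Formula.and φ ψ ∈ x ↔ φ ∈ x ∧ ψ ∈ x := by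
  refine ⟨fun h => ⟨?_, ?_⟩, fun h => ?_⟩
  · exact hx.mem_of_entails (l := [Formula.and φ ψ]) (by simp [h]) hφ
      (fun v hv => by simp +contextual [hv.and_eq_true])
  · exact hx.mem_of_entails (l := [Formula.and φ ψ]) (by simp [h]) hψ
      (fun v hv => by simp +contextual [hv.and_eq_true])
  · exact hx.mem_of_entails (l := [φ, ψ]) (φ := .and φ ψ) (by simp [h]) ⟨hφ, hψ⟩
      (fun v hv => by simp +contextual [hv.and_eq_true])

theorem or_mem_iff (hx : MCS (JnLin n) n x) {φ ψ : Formula} (hφ : Formula.InLang n φ)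
    (hψ : Formula.InLang n ψ) : Formula.or φ ψ ∈ x ↔ φ ∈ x ∨ ψ ∈ x := by
  refine ⟨fun h => ?_, ?_⟩
  · by_contra! hnot
    rw [← hx.neg_mem_iff hφ, ← hx.neg_mem_iff hψ] at hnot
    refine (hx.neg_mem_iff hφ).1 hnot.1
      (hx.mem_of_entails (l := [Formula.or φ ψ, Formula.neg ψ]) (by simp [h, hnot]) hφ
        fun v hv => ?_)
    simp only [List.forall_mem_cons, hv.or_eq_true, hv.neg_eq_true]
    tauto
  · rintro (h | h)
    · exact hx.mem_of_entails (l := [φ]) (φ := .or φ ψ) (by simp [h]) ⟨hφ, hψ⟩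
        (fun v hv => by simp +contextual [hv.or_eq_true])
    · exact hx.mem_of_entails (l := [ψ]) (φ := .or φ ψ) (by simp [h]) ⟨hφ, hψ⟩
        (fun v hv => by simp +contextual [hv.or_eq_true])

theorem imp_mem_iff (hx : MCS (JnLin n) n x) {φ ψ : Formula} (hφ : Formula.InLang n φ)
    (hψ : Formula.InLang n ψ) : Formula.imp φ ψ ∈ x ↔ (φ ∈ x → ψ ∈ x) := by
  refine ⟨fun h => hx.mem_of_imp_mem h, fun h => ?_⟩
  by_cases hmem : φ ∈ x
  · exact hx.mem_of_entails (l := [ψ]) (φ := .imp φ ψ) (by simp [h hmem]) ⟨hφ, hψ⟩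
      (fun v hv => by simp +contextual [hv.imp_eq_true])
  · refine hx.mem_of_entails (l := [Formula.neg φ]) (by simp [(hx.neg_mem_iff hφ).2 hmem])
      ⟨hφ, hψ⟩ (fun v hv => ?_)
    simp only [List.forall_mem_cons, hv.imp_eq_true, hv.neg_eq_true]
    tauto

/-- The set of `ψ` with `[m]ψ ∈ x` is deductively closed. -/
theorem box_mem_of_provable_imp (hx : MCS (JnLin n) n x) {m : ℕ} (hm : m < n)
    {l : List Formula} (hl : ∀ a ∈ l, Formula.box m a ∈ x) {χ : Formula}
    (hχ : Formula.InLang n χ) (h : JnLin n (Formula.imp (bigConj l) χ)) :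
    Formula.box m χ ∈ x := by
  induction l generalizing χ with
  | nil =>
    exact hx.mem_of_provable (φ := .box m χ) ⟨hm, hχ⟩
      (.nec hm (.mp h (.taut (fun _ hv => hv.1) trivial)))
  | cons a l ih =>
    have ha : Formula.InLang n a := (hx.1 _ (hl a (by simp))).2
    have hlang : Formula.InLang n (bigConj l) :=
      inLang_bigConj fun b hb => (hx.1 _ (hl b (by simp [hb]))).2
    have hbox : Formula.box m (Formula.imp a χ) ∈ x := by
      refine ih (χ := .imp a χ) (fun b hb => hl b (by simp [hb])) ⟨ha, hχ⟩
        (.mp (φ := .imp (bigConj (a :: l)) χ) (.taut (fun v hv => ?_) ⟨⟨⟨ha, hlang⟩, hχ⟩, hlang, ha, hχ⟩) h)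
      simp only [hv.imp_eq_true, hv.bigConj_eq_true, List.forall_mem_cons]
      tauto
    have hdistr := hx.mem_of_provable (φ := .imp (.box m (.imp a χ)) (.imp (.box m a) (.box m χ)))
      ⟨⟨hm, ha, hχ⟩, ⟨hm, ha⟩, hm, hχ⟩ (.distr hm a χ ha hχ)
    exact hx.mem_of_imp_mem (hx.mem_of_imp_mem hdistr hbox) (hl a (by simp))

/-- If `[m]φ ∉ x`, then `x` has a canonical `<_m`-successor omitting `φ`. -/
theorem exists_canonR_not_mem (hx : MCS (JnLin n) n x) {m : ℕ} (hm : m < n) {φ : Formula}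
    (hφ : Formula.InLang n φ) (hmem : Formula.box m φ ∉ x) :
    ∃ y, MCS (JnLin n) n y ∧ canonR m x y ∧ φ ∉ y := by
  obtain ⟨y, hsub, hy⟩ := SetConsistent.exists_mcs (L := JnLin n) (n := n)
    (S := insert (Formula.box m φ) (insert (Formula.neg φ) {ψ | Formula.box m ψ ∈ x}))
    (by
      rintro a (rfl | rfl | ha)
      exacts [⟨hm, hφ⟩, hφ, (hx.1 _ ha).2])
    (by
      intro l hl hprov
      have hrest : ∀ a ∈ l.filter fun a => a ≠ Formula.box m φ ∧ a ≠ Formula.neg φ,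
          Formula.box m a ∈ x := by
        intro a ha
        simp only [List.mem_filter, decide_eq_true_eq] at ha
        exact ((hl a ha.1).resolve_left ha.2.1).resolve_left ha.2.2
      have hllang : ∀ a ∈ l, Formula.InLang n a := fun a ha => by
        rcases hl a ha with rfl | rfl | ha
        exacts [⟨hm, hφ⟩, hφ, (hx.1 _ ha).2]
      have hlob := hx.mem_of_provable (φ := .imp (.box m (.imp (.box m φ) φ)) (.box m φ))
        ⟨⟨hm, ⟨hm, hφ⟩, hφ⟩, hm, hφ⟩ (.lob hm φ hφ)
      refine hmem (hx.mem_of_imp_mem hlob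
        (hx.box_mem_of_provable_imp hm hrest ⟨⟨hm, hφ⟩, hφ⟩
          (.mp (.taut (fun v hv => ?_) ?_) hprov)))
      · simp only [hv.imp_eq_true, hv.neg_eq_true, hv.bigConj_eq_true]
        intro h₁ h₂ h₃
        by_contra h₄
        refine h₁ fun a ha => ?_
        by_cases h₅ : a = Formula.box m φ
        · exact h₅ ▸ h₃
        by_cases h₆ : a = Formula.neg φ
        · exact h₆ ▸ (hv.neg_eq_true φ).2 h₄
        exact h₂ a (by simp [ha, h₅, h₆])
      · exact ⟨inLang_bigConj hllang, inLang_bigConj fun a ha => (hx.1 _ (hrest a ha)).2,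
          ⟨hm, hφ⟩, hφ⟩)
  exact ⟨y, hy, ⟨fun ψ hψ => hsub (by simp [hψ]), φ, hsub (by simp), hmem⟩,
    (hy.neg_mem_iff hφ).1 (hsub (by simp))⟩

end MCS

/-- Truth lemma for the canonical model of `J_n.lin`: with the natural
valuation, a formula of `L_{[<n]}` holds at a world iff it belongs to it. -/
theorem canonical_truth_lemma (n : ℕ) (ψ : Formula) (hψ : Formula.InLang n ψ)
    (x : {S : Set Formula // MCS (JnLin n) n S}) :
    Sat (fun m (a b : {S : Set Formula // MCS (JnLin n) n S}) => canonR m a.val b.val)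
        (fun p a => Formula.var p ∈ a.val) x ψ ↔ ψ ∈ x.val := by
  induction ψ generalizing x with
  | var p => exact Iff.rfl
  | top =>
    exact iff_of_true trivial
      (x.2.mem_of_provable trivial (.taut (fun _ hv => hv.1) trivial))
  | neg a iha => exact (not_congr (iha hψ x)).trans (x.2.neg_mem_iff (φ := a) hψ).symm
  | and a b iha ihb =>
    exact (and_congr (iha hψ.1 x) (ihb hψ.2 x)).trans (x.2.and_mem_iff hψ.1 hψ.2).symm
  | or a b iha ihb =>
    exact (or_congr (iha hψ.1 x) (ihb hψ.2 x)).trans (x.2.or_mem_iff hψ.1 hψ.2).symm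
  | imp a b iha ihb =>
    exact (imp_congr (iha hψ.1 x) (ihb hψ.2 x)).trans (x.2.imp_mem_iff hψ.1 hψ.2).symm
  | box m a iha =>
    refine ⟨fun h => ?_, fun h y hxy => (iha hψ.2 y).2 (hxy.1 a h)⟩
    by_contra hmem
    obtain ⟨y, hy, hxy, hay⟩ := x.2.exists_canonR_not_mem hψ.1 hψ.2 hmem
    exact hay ((iha hψ.2 ⟨y, hy⟩).1 (h ⟨y, hy⟩ hxy))
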